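/- Let X be a decomposable continuum that is irreducible between points p and q, and set C = X \ κ(q) and D = X \ κ(p). Then neither C nor D is a nonempty closed subset of X if and only if NB(F₁(X)) = ∅. -/

import Mathlib

open Set Filter Metric

/-- `B` does not block `x`: the union of all subcontinua of `X` containing `x`
and contained in the complement of `B` is dense. -/
def NotBlocks {X : Type*} [TopologicalSpace X] (B : Set X) (x : X) : Prop :=
  Dense (⋃₀ {K : Set X | IsCompact K ∧ IsConnected K ∧ x ∈ K ∧ K ⊆ Bᶜ})

/-- The hyperspace `NB(F₁(X))`: nonempty proper closed subsets that do not block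
any point of their complement. -/
def NB (X : Type*) [TopologicalSpace X] : Set (Set X) :=
  {B | B.Nonempty ∧ B ≠ univ ∧ IsClosed B ∧ ∀ x ∉ B, NotBlocks B x}

/-- The hyperspace `NB*(F₁(X))`: nonempty proper closed subsets that do not block
at least one point of their complement. -/
def NBstar (X : Type*) [TopologicalSpace X] : Set (Set X) :=
  {B | B.Nonempty ∧ B ≠ univ ∧ IsClosed B ∧ ∃ x ∉ B, NotBlocks B x}

/-- `F₁(X)`: the one-point subsets of `X`. -/
def F1 (X : Type*) [TopologicalSpace X] : Set (Set X) :=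
  {A | ∃ x : X, A = {x}}

/-- `NWC(X)`: nonempty proper closed subsets with empty interior that are
non-weak cut sets. -/
def NWC (X : Type*) [TopologicalSpace X] : Set (Set X) :=
  {A | A.Nonempty ∧ A ≠ univ ∧ IsClosed A ∧ interior A = ∅ ∧
    ∀ x ∉ A, ∀ y ∉ A, ∃ K : Set X, IsCompact K ∧ IsConnected K ∧ K ⊆ Aᶜ ∧ x ∈ K ∧ y ∈ K}

/-- A shore set: a nonempty proper closed subset `A` such that some sequence of
subcontinua contained in the complement of `A` converges to `X` in the Hausdorff metric. -/
def ShoreSet {X : Type*} [MetricSpace X] (A : Set X) : Prop :=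
  A.Nonempty ∧ A ≠ univ ∧ IsClosed A ∧
    ∃ C : ℕ → Set X, (∀ n, IsCompact (C n) ∧ IsConnected (C n) ∧ C n ⊆ Aᶜ) ∧
      Tendsto (fun n => hausdorffDist (C n) (univ : Set X)) atTop (nhds 0)

/-- `S(X)`: the collection of all shore sets of `X`. -/
def Shore (X : Type*) [MetricSpace X] : Set (Set X) :=
  {A | ShoreSet A}

/-- The composant of a point `z`: the union of all proper subcontinua containing `z`. -/
def composant {X : Type*} [TopologicalSpace X] (z : X) : Set X :=
  ⋃₀ {L : Set X | IsCompact L ∧ IsConnected L ∧ L ≠ univ ∧ z ∈ L}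

/-- `X` is irreducible between `p` and `q`: no proper subcontinuum contains both. -/
def IrrBetween {X : Type*} [TopologicalSpace X] (p q : X) : Prop :=
  ∀ L : Set X, IsCompact L → IsConnected L → p ∈ L → q ∈ L → L = univ

/-- A subcontinuum `K` is decomposable if it is the union of two proper subcontinua. -/
def DecomposableSet {X : Type*} [TopologicalSpace X] (K : Set X) : Prop :=
  ∃ A B : Set X, IsCompact A ∧ IsConnected A ∧ A ⊆ K ∧ A ≠ K ∧
    IsCompact B ∧ IsConnected B ∧ B ⊆ K ∧ B ≠ K ∧ A ∪ B = K

/-- `s(x)` relative to the point `p`: the union of all subcontinua containing `x`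
and contained in `X \ {p}`. -/
def sComp {X : Type*} [TopologicalSpace X] (p x : X) : Set X :=
  ⋃₀ {K : Set X | IsCompact K ∧ IsConnected K ∧ x ∈ K ∧ K ⊆ ({p} : Set X)ᶜ}

/-- A subcontinuum: a compact connected subset. -/
def IsSubcontinuum {X : Type*} [TopologicalSpace X] (K : Set X) : Prop :=
  IsCompact K ∧ IsConnected K

namespace IsSubcontinuum

theorem union {X : Type*} [TopologicalSpace X] {K L : Set X} (hK : IsSubcontinuum K)
    (hL : IsSubcontinuum L) (h : (K ∩ L).Nonempty) : IsSubcontinuum (K ∪ L) :=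
  ⟨hK.1.union hL.1, hK.2.union h hL.2⟩

theorem isClosed {X : Type*} [TopologicalSpace X] [T2Space X] {K : Set X}
    (hK : IsSubcontinuum K) : IsClosed K :=
  hK.1.isClosed

end IsSubcontinuum

theorem IrrBetween.symm {X : Type*} [TopologicalSpace X] {p q : X} (h : IrrBetween p q) :
    IrrBetween q p :=
  fun L hL hL' hq hp => h L hL hL' hp hq

theorem IrrBetween.eq_univ {X : Type*} [TopologicalSpace X] {p q : X} (h : IrrBetween p q)
    {L : Set X} (hL : IsSubcontinuum L) (hp : p ∈ L) (hq : q ∈ L) : L = univ :=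
  h L hL.1 hL.2 hp hq

/-- Adding to a connected closed set `N` one side of a separation of the rest of a connected
set leaves a connected set. -/
theorem isPreconnected_union_of_disjoint {X : Type*} [TopologicalSpace X] {N E F : Set X}
    (hY : IsPreconnected (N ∪ E ∪ F)) (hN : IsConnected N) (hNc : IsClosed N)
    (hE : IsClosed E) (hF : IsClosed F) (hEF : Disjoint E F) : IsPreconnected (N ∪ E) := by
  have key : ∀ g h : Set X, IsClosed g → IsClosed h → N ∪ E ⊆ g ∪ h → Disjoint g h →
      N ⊆ g → N ∪ E ⊆ g := by
    intro g h hg hh hcov hgh hNg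
    have hYc : IsClosed (N ∪ E ∪ F) := (hNc.union hE).union hF
    rw [isPreconnected_iff_subset_of_fully_disjoint_closed hYc] at hY
    rw [Set.disjoint_left] at hEF hgh
    rcases hY (E ∩ h) (N ∪ F ∪ (E ∩ g)) (hE.inter hh) ((hNc.union hF).union (hE.inter hg))
      (by
        rintro x ((hx | hx) | hx)
        · exact Or.inr (Or.inl (Or.inl hx))
        · rcases hcov (Or.inr hx) with h1 | h1
          · exact Or.inr (Or.inr ⟨hx, h1⟩)
          · exact Or.inl ⟨hx, h1⟩
        · exact Or.inr (Or.inl (Or.inr hx)))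
      (by
        rw [Set.disjoint_left]
        rintro x ⟨hxE, hxh⟩ ((hx | hx) | hx)
        · exact hgh (hNg hx) hxh
        · exact hEF hxE hx
        · exact hgh hx.2 hxh) with h1 | h1
    · obtain ⟨n, hn⟩ := hN.nonempty
      exact absurd (h1 (Or.inl (Or.inl hn))).2 (hgh (hNg hn))
    · rintro x (hx | hx)
      · exact hNg hx
      · rcases h1 (Or.inl (Or.inr hx)) with (h2 | h2) | h2
        · exact hNg h2
        · exact absurd h2 (hEF hx)
        · exact h2.2
  rw [isPreconnected_iff_subset_of_fully_disjoint_closed (hNc.union hE)]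
  intro g h hg hh hcov hgh
  rcases (isPreconnected_iff_subset_of_fully_disjoint_closed hNc).1 hN.isPreconnected g h hg hh
    (subset_union_left.trans hcov) hgh with h1 | h1
  · exact Or.inl (key g h hg hh hcov hgh h1)
  · exact Or.inr (key h g hh hg (by rwa [union_comm h g]) hgh.symm h1)

/-- Either the closure of `Y \ N` is connected, or `Y` is the union of two proper
subcontinua containing `N`. -/
theorem isPreconnected_closure_diff_or {X : Type*} [TopologicalSpace X] [T2Space X]
    {Y N : Set X} (hY : IsSubcontinuum Y) (hN : IsSubcontinuum N) (hNY : N ⊆ Y) :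
    IsPreconnected (closure (Y \ N)) ∨ ∃ R S : Set X, IsSubcontinuum R ∧ IsSubcontinuum S ∧
      R ∪ S = Y ∧ R ≠ Y ∧ S ≠ Y ∧ N ⊆ R ∧ N ⊆ S := by
  by_cases hpre : IsPreconnected (closure (Y \ N))
  · exact Or.inl hpre
  right
  rw [isPreconnected_iff_subset_of_fully_disjoint_closed isClosed_closure] at hpre
  push Not at hpre
  obtain ⟨u, v, hu, hv, hcov, huv, hnu, hnv⟩ := hpre
  set Z := closure (Y \ N) with hZ
  have hZY : Z ⊆ Y := closure_minimal sdiff_subset hY.isClosed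
  have hZc : IsClosed Z := isClosed_closure
  have hYeq : N ∪ (Z ∩ u) ∪ (Z ∩ v) = Y := by
    apply Subset.antisymm
    · rintro x ((hx | hx) | hx)
      exacts [hNY hx, hZY hx.1, hZY hx.1]
    · intro x hx
      by_cases hxN : x ∈ N
      · exact Or.inl (Or.inl hxN)
      · have hxZ : x ∈ Z := subset_closure ⟨hx, hxN⟩
        rcases hcov hxZ with h | h
        · exact Or.inl (Or.inr ⟨hxZ, h⟩)
        · exact Or.inr ⟨hxZ, h⟩
  have hYeq' : N ∪ (Z ∩ v) ∪ (Z ∩ u) = Y := by rw [union_right_comm, hYeq]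
  have hdisj : Disjoint (Z ∩ u) (Z ∩ v) := huv.mono inter_subset_right inter_subset_right
  have hproper : ∀ w w' : Set X, IsClosed w → Disjoint w w' → ¬ Z ⊆ w → N ∪ (Z ∩ w) ≠ Y := by
    intro w w' hw hww hnw heq
    apply hnw
    refine closure_minimal ?_ hw
    rintro x ⟨hxY, hxN⟩
    rw [← heq] at hxY
    rcases hxY with h | h
    · exact absurd h hxN
    · exact h.2
  have hsub : ∀ w, IsClosed w → IsPreconnected (N ∪ (Z ∩ w)) → IsSubcontinuum (N ∪ (Z ∩ w)) := by
    intro w hw hc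
    refine ⟨hY.1.of_isClosed_subset (hN.isClosed.union (hZc.inter hw)) ?_,
      hN.2.nonempty.mono subset_union_left, hc⟩
    exact union_subset hNY (inter_subset_left.trans hZY)
  refine ⟨N ∪ (Z ∩ u), N ∪ (Z ∩ v), hsub u hu ?_, hsub v hv ?_, ?_, hproper u v hu huv hnu,
    hproper v u hv huv.symm hnv, subset_union_left, subset_union_left⟩
  · exact isPreconnected_union_of_disjoint (by rw [hYeq]; exact hY.2.isPreconnected) hN.2
      hN.isClosed (hZc.inter hu) (hZc.inter hv) hdisj
  · exact isPreconnected_union_of_disjoint (by rw [hYeq']; exact hY.2.isPreconnected) hN.2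
      hN.isClosed (hZc.inter hv) (hZc.inter hu) hdisj.symm
  · rw [← hYeq]
    ext x
    simp only [mem_union]
    tauto

/-- Boundary bumping: in a continuum `P` covered by closed sets `S` and `Q`, the component in
`P ∩ Q` of a point meets `S`. -/
theorem connectedComponentIn_inter_nonempty {X : Type*} [TopologicalSpace X] [T2Space X]
    {P S Q : Set X} (hP : IsSubcontinuum P) (hS : IsClosed S) (hQ : IsClosed Q)
    (hcov : P ⊆ S ∪ Q) (hPS : (P ∩ S).Nonempty) {c : X} (hc : c ∈ P ∩ Q) :
    (connectedComponentIn (P ∩ Q) c ∩ S).Nonempty := by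
  by_contra hne
  have hFc : IsCompact (P ∩ Q) := hP.1.inter_right hQ
  have : CompactSpace ↥(P ∩ Q) := isCompact_iff_compactSpace.1 hFc
  have hsub : connectedComponent (⟨c, hc⟩ : ↥(P ∩ Q)) ⊆ (Subtype.val ⁻¹' S)ᶜ := by
    intro y hy hyS
    apply hne
    refine ⟨y, ?_, hyS⟩
    rw [connectedComponentIn_eq_image hc]
    exact ⟨y, hy, rfl⟩
  rw [connectedComponent_eq_iInter_isClopen] at hsub
  have : Nonempty {s : Set ↥(P ∩ Q) // IsClopen s ∧ ⟨c, hc⟩ ∈ s} :=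
    ⟨⟨univ, isClopen_univ, mem_univ _⟩⟩
  obtain ⟨⟨G, hG, hcG⟩, hGS⟩ := exists_subset_nhds_of_compactSpace
    (V := fun s : {s : Set ↥(P ∩ Q) // IsClopen s ∧ ⟨c, hc⟩ ∈ s} => (s : Set ↥(P ∩ Q)))
    (by
      rintro ⟨s, hs, hs'⟩ ⟨t, ht, ht'⟩
      exact ⟨⟨s ∩ t, hs.inter ht, hs', ht'⟩, inter_subset_left, inter_subset_right⟩)
    (fun s => s.2.1.isClosed)
    (U := (Subtype.val ⁻¹' S)ᶜ)
    (fun x hx => (hS.preimage continuous_subtype_val).isOpen_compl.mem_nhds (hsub hx))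
  simp only at hGS
  have hemb := hFc.isClosed.isClosedEmbedding_subtypeVal
  have hG1 : IsClosed (Subtype.val '' G) := hemb.isClosedMap _ hG.isClosed
  have hG2 : IsClosed (Subtype.val '' Gᶜ) := hemb.isClosedMap _ hG.compl.isClosed
  rcases (isPreconnected_iff_subset_of_fully_disjoint_closed hP.isClosed).1
    hP.2.isPreconnected (Subtype.val '' G) (S ∪ Subtype.val '' Gᶜ) hG1 (hS.union hG2)
    (by
      intro x hx
      rcases hcov hx with h | h
      · exact Or.inr (Or.inl h)
      · by_cases hxG : (⟨x, hx, h⟩ : ↥(P ∩ Q)) ∈ G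
        · exact Or.inl ⟨_, hxG, rfl⟩
        · exact Or.inr (Or.inr ⟨_, hxG, rfl⟩))
    (by
      rw [Set.disjoint_left]
      rintro x ⟨y, hy, rfl⟩ (h | ⟨z, hz, hzy⟩)
      · exact hGS hy h
      · exact hz (Subtype.ext hzy ▸ hy)) with h | h
  · obtain ⟨s, hsP, hsS⟩ := hPS
    obtain ⟨y, hy, rfl⟩ := h hsP
    exact hGS hy hsS
  · rcases h hc.1 with h | ⟨z, hz, hzc⟩
    · exact hGS hcG h
    · apply hz
      have : z = ⟨c, hc⟩ := Subtype.ext hzc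
      rwa [this]

theorem isSubcontinuum_connectedComponentIn {X : Type*} [TopologicalSpace X] [T2Space X]
    {F : Set X} (hF : IsCompact F) {c : X} (hc : c ∈ F) :
    IsSubcontinuum (connectedComponentIn F c) := by
  refine ⟨?_, isConnected_connectedComponentIn_iff.2 hc⟩
  have : CompactSpace F := isCompact_iff_compactSpace.1 hF
  rw [connectedComponentIn_eq_image hc]
  exact (isClosed_connectedComponent.isCompact).image continuous_subtype_val

theorem subset_composant {X : Type*} [TopologicalSpace X] {z : X} {L : Set X}
    (hL : IsSubcontinuum L) (hne : L ≠ univ) (hz : z ∈ L) : L ⊆ composant z :=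
  fun _ hx => ⟨L, ⟨hL.1, hL.2, hne, hz⟩, hx⟩

theorem exists_of_mem_composant {X : Type*} [TopologicalSpace X] {z x : X}
    (hx : x ∈ composant z) : ∃ L : Set X, IsSubcontinuum L ∧ L ≠ univ ∧ z ∈ L ∧ x ∈ L := by
  obtain ⟨L, ⟨h1, h2, h3, h4⟩, h5⟩ := hx
  exact ⟨L, ⟨h1, h2⟩, h3, h4, h5⟩

/-- Every composant of a continuum is dense. -/
theorem dense_composant {X : Type*} [TopologicalSpace X] [T2Space X] [CompactSpace X]
    [ConnectedSpace X] [Nontrivial X] (z : X) : Dense (composant z) := by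
  rw [dense_iff_inter_open]
  by_contra! h
  obtain ⟨U, hU, ⟨y, hy⟩, hUe⟩ := h
  obtain ⟨V, hV, hyV, hVU⟩ : ∃ V, IsOpen V ∧ y ∈ V ∧ closure V ⊆ U := by
    obtain ⟨t, ht, htc, htU⟩ := exists_mem_nhds_isClosed_subset (hU.mem_nhds hy)
    refine ⟨interior t, isOpen_interior, mem_interior_iff_mem_nhds.2 ht, ?_⟩
    exact (closure_minimal interior_subset htc).trans htU
  have hVemp : ∀ x ∈ closure V, x ∉ composant z := fun x hx hxz =>
    (hUe ▸ (⟨hVU hx, hxz⟩ : x ∈ U ∩ composant z) : x ∈ (∅ : Set X))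
  have hcompV : IsClosed Vᶜ := hV.isClosed_compl
  have hzV : z ∈ Vᶜ := by
    intro hz
    refine hVemp z (subset_closure hz) (subset_composant (L := {z})
      ⟨isCompact_singleton, isConnected_singleton⟩ ?_ rfl rfl)
    obtain ⟨w, hw⟩ := exists_ne z
    exact fun h => hw (h ▸ mem_univ w : w ∈ ({z} : Set X))
  have huniv : IsSubcontinuum (univ : Set X) := ⟨isCompact_univ, isConnected_univ⟩
  have hT := isSubcontinuum_connectedComponentIn (F := univ ∩ Vᶜ)
    (isCompact_univ.inter_right hcompV) (c := z) ⟨mem_univ z, hzV⟩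
  obtain ⟨x, hx, hxV⟩ := connectedComponentIn_inter_nonempty huniv
    (isClosed_closure (s := V)) hcompV
    (fun x _ => (em (x ∈ V)).imp (fun h => subset_closure h) id)
    ⟨y, mem_univ y, subset_closure hyV⟩ (c := z) ⟨mem_univ z, hzV⟩
  refine hVemp x hxV (subset_composant hT ?_ (mem_connectedComponentIn ⟨mem_univ z, hzV⟩) hx)
  intro h
  have : y ∈ connectedComponentIn (univ ∩ Vᶜ) z := by
    rw [h]
    exact mem_univ y
  exact (connectedComponentIn_subset _ _ this).2 hyV

/-- In a continuum irreducible between `p` and `q`, the closure of the complement of a proper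
subcontinuum containing `q` is a continuum containing `p`. -/
theorem IrrBetween.isSubcontinuum_closure_compl {X : Type*} [TopologicalSpace X]
    [T2Space X] [CompactSpace X] [ConnectedSpace X] {p q : X} (h : IrrBetween p q) {N : Set X}
    (hN : IsSubcontinuum N) (hq : q ∈ N) (hne : N ≠ univ) :
    IsSubcontinuum (closure Nᶜ) ∧ p ∈ closure Nᶜ := by
  have hp : p ∈ closure Nᶜ := subset_closure fun hp => hne (h.eq_univ hN hp hq)
  refine ⟨⟨isClosed_closure.isCompact, ⟨p, hp⟩, ?_⟩, hp⟩
  rw [compl_eq_univ_sdiff]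
  rcases isPreconnected_closure_diff_or (Y := univ) ⟨isCompact_univ, isConnected_univ⟩ hN
    (subset_univ N) with h1 | ⟨R, S, hR, hS, hRS, hR', hS', hNR, hNS⟩
  · exact h1
  · rcases (hRS ▸ mem_univ p : p ∈ R ∪ S) with h2 | h2
    · exact (hR' (h.eq_univ hR h2 (hNR hq))).elim
    · exact (hS' (h.eq_univ hS h2 (hNS hq))).elim

/-- A proper subcontinuum of an indecomposable continuum is nowhere dense in it. -/
theorem closure_diff_eq_of_not_decomposableSet {X : Type*} [TopologicalSpace X] [T2Space X]
    {Q R : Set X} (hQ : IsSubcontinuum Q) (hR : IsSubcontinuum R) (hRQ : R ⊆ Q) (hne : R ≠ Q)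
    (hdec : ¬ DecomposableSet Q) : closure (Q \ R) = Q := by
  by_contra hcl
  apply hdec
  have hsub : closure (Q \ R) ⊆ Q := closure_minimal sdiff_subset hQ.isClosed
  rcases isPreconnected_closure_diff_or hQ hR hRQ with h | ⟨S, T, hS, hT, hST, hS', hT', -, -⟩
  · refine ⟨R, closure (Q \ R), hR.1, hR.2, hRQ, hne, hQ.1.of_isClosed_subset isClosed_closure hsub,
      ⟨?_, h⟩, hsub, hcl, Subset.antisymm (union_subset hRQ hsub) ?_⟩
    · by_contra! hemp
      have := closure_empty_iff _ |>.1 hemp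
      exact hne (Subset.antisymm hRQ (sdiff_eq_empty.1 this))
    · intro x hx
      by_cases hxR : x ∈ R
      · exact Or.inl hxR
      · exact Or.inr (subset_closure ⟨hx, hxR⟩)
  · exact ⟨S, T, hS.1, hS.2, hST ▸ subset_union_left, hS', hT.1, hT.2,
      hST ▸ subset_union_right, hT', hST⟩

/-- A composant is contained in a countable union of proper subcontinua. -/
theorem exists_seq_subcontinuum_of_composant {X : Type*} [TopologicalSpace X] [T2Space X]
    [CompactSpace X] [SecondCountableTopology X] (z : X) :
    ∃ L : TopologicalSpace.countableBasis X → Set X, (∀ i, IsClosed (L i)) ∧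
      (∀ i, (L i).Nonempty → IsSubcontinuum (L i) ∧ L i ≠ univ ∧ z ∈ L i) ∧
      composant z ⊆ ⋃ i, L i := by
  refine ⟨fun V => connectedComponentIn (V : Set X)ᶜ z, ?_, ?_, ?_⟩
  · rintro ⟨V, hV⟩
    have hVo := TopologicalSpace.isOpen_of_mem_countableBasis hV
    by_cases hz : z ∈ Vᶜ
    · exact (isSubcontinuum_connectedComponentIn hVo.isClosed_compl.isCompact hz).isClosed
    · simp only [connectedComponentIn_eq_empty hz, isClosed_empty]
  · rintro ⟨V, hV⟩ hne
    have hVo := TopologicalSpace.isOpen_of_mem_countableBasis hV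
    have hz : z ∈ Vᶜ := connectedComponentIn_nonempty_iff.1 hne
    refine ⟨isSubcontinuum_connectedComponentIn hVo.isClosed_compl.isCompact hz, ?_,
      mem_connectedComponentIn hz⟩
    intro h
    obtain ⟨y, hy⟩ := TopologicalSpace.nonempty_of_mem_countableBasis hV
    have : y ∈ connectedComponentIn Vᶜ z := by
      have := mem_univ y
      rwa [← h] at this
    exact connectedComponentIn_subset _ _ this hy
  · intro x hx
    obtain ⟨L, hL, hLne, hzL, hxL⟩ := exists_of_mem_composant hx
    obtain ⟨y, hy⟩ := (ne_univ_iff_exists_notMem L).1 hLne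
    obtain ⟨V, hV, -, hVL⟩ := (TopologicalSpace.isBasis_countableBasis X).exists_subset_of_mem_open
      (show y ∈ Lᶜ from hy) hL.isClosed.isOpen_compl
    exact mem_iUnion.2 ⟨⟨V, hV⟩, hL.2.isPreconnected.subset_connectedComponentIn hzL
      (subset_compl_comm.1 hVL) hxL⟩

/-- If the closure of the complement of a proper subcontinuum containing `q` is indecomposable,
then the complement of the composant of `q` is dense in it. -/
theorem IrrBetween.compl_subset_closure {X : Type*} [TopologicalSpace X] [T2Space X]
    [CompactSpace X] [ConnectedSpace X] [SecondCountableTopology X] {p q : X}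
    (h : IrrBetween p q) {P : Set X} (hP : IsSubcontinuum P) (hq : q ∈ P) (hne : P ≠ univ)
    (hdec : ¬ DecomposableSet (closure Pᶜ)) : Pᶜ ⊆ closure (composant q)ᶜ := by
  by_contra hnot
  obtain ⟨y, hyP, hy⟩ := not_subset.1 hnot
  set W : Set X := Pᶜ ∩ (closure (composant q)ᶜ)ᶜ with hW
  have hWo : IsOpen W := hP.isClosed.isOpen_compl.inter isClosed_closure.isOpen_compl
  have hWc : W ⊆ composant q := fun x hx => by_contra fun hxn => hx.2 (subset_closure hxn)
  obtain ⟨L, hLc, hL, hcov⟩ := exists_seq_subcontinuum_of_composant q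
  have hdense := dense_iUnion_interior_of_closed (X := X) 
    (f := fun i : Option (TopologicalSpace.countableBasis X) => i.elim Wᶜ L)
    (by
      rintro (_ | i)
      · exact hWo.isClosed_compl
      · exact hLc i)
    (by
      refine eq_univ_of_forall fun x => mem_iUnion.2 ?_
      by_cases hx : x ∈ W
      · obtain ⟨i, hi⟩ := mem_iUnion.1 (hcov (hWc hx))
        exact ⟨some i, hi⟩
      · exact ⟨none, hx⟩)
  obtain ⟨x, hxW, hx⟩ := dense_iff_inter_open.1 hdense W hWo ⟨y, hyP, hy⟩
  obtain ⟨_ | i, hi⟩ := mem_iUnion.1 hx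
  · exact interior_subset hi hxW
  change x ∈ interior (L i) at hi
  obtain ⟨hLi, hLne, hqL⟩ := hL i ⟨x, interior_subset hi⟩
  have hM : IsSubcontinuum (L i ∪ P) := hLi.union hP ⟨q, hqL, hq⟩
  have hpM : p ∉ L i ∪ P := by
    rintro (hp | hp)
    · exact hLne (h.eq_univ hLi hp hqL)
    · exact hne (h.eq_univ hP hp hq)
  have hMne : L i ∪ P ≠ univ := fun hu => hpM (hu ▸ mem_univ p)
  obtain ⟨hR, -⟩ := h.isSubcontinuum_closure_compl hM (Or.inl hqL) hMne
  obtain ⟨hQ, hpQ⟩ := h.isSubcontinuum_closure_compl hP hq hne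
  have hRQ : closure (L i ∪ P)ᶜ ⊆ closure Pᶜ :=
    closure_mono (compl_subset_compl.2 subset_union_right)
  have hRne : closure (L i ∪ P)ᶜ ≠ closure Pᶜ := by
    intro heq
    have hxQ : x ∈ closure (L i ∪ P)ᶜ := heq ▸ subset_closure hxW.1
    obtain ⟨z, hz, hz'⟩ := mem_closure_iff.1 hxQ _ isOpen_interior hi
    exact hz' (Or.inl (interior_subset hz))
  rw [← closure_diff_eq_of_not_decomposableSet hQ hR hRQ hRne hdec] at hpQ
  obtain ⟨z, hz, hz'⟩ := mem_closure_iff.1 hpQ _ hM.isClosed.isOpen_compl hpM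
  exact hz'.2 (subset_closure hz)

/-- If `c` is a limit point of the complement of the composant of `q` lying in a proper
subcontinuum `P` containing `q` but not in the closure of the interior of `P`, then the closure
of the complement of `P` is indecomposable. -/
theorem IrrBetween.not_decomposableSet_closure_compl {X : Type*} [TopologicalSpace X] [T2Space X]
    [CompactSpace X] [ConnectedSpace X] {p q c : X} (h : IrrBetween p q) {P : Set X}
    (hP : IsSubcontinuum P) (hq : q ∈ P) (hne : P ≠ univ) (hint : (interior P).Nonempty)
    (hcC : c ∈ closure (composant q)ᶜ) (hcP : c ∈ P) (hcP' : c ∉ closure (interior P)) :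
    ¬ DecomposableSet (closure Pᶜ) := by
  obtain ⟨hQ, hpQ⟩ := h.isSubcontinuum_closure_compl hP hq hne
  set Q := closure Pᶜ with hQdef
  have hintQ : interior P = Qᶜ := by rw [hQdef, closure_compl, compl_compl]
  have hQne : Q ≠ univ := by
    intro hu
    rw [hintQ, hu, compl_univ] at hint
    exact not_nonempty_empty hint
  rw [hintQ] at hcP'
  obtain ⟨hP', hqP'⟩ := h.symm.isSubcontinuum_closure_compl hQ hpQ hQne
  set P' := closure Qᶜ with hP'def
  have hcov : P' ∪ Q = univ := eq_univ_of_forall fun x =>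
    (em (x ∈ Q)).elim Or.inr fun hx => Or.inl (subset_closure hx)
  have hP'P : P' ⊆ P := by
    rw [hP'def, ← hintQ]
    exact closure_minimal interior_subset hP.isClosed
  have key : ∀ S : Set X, IsClosed S → S ∪ P' = univ → Q ⊆ S := by
    intro S hS hu
    refine closure_minimal (fun x hx => ?_) hS
    exact (hu ▸ mem_univ x : x ∈ S ∪ P').resolve_right fun hx' => hx (hP'P hx')
  have hcQ : c ∈ Q := (hcov ▸ mem_univ c : c ∈ P' ∪ Q).resolve_left hcP'
  have hPQ : c ∈ P ∩ Q := ⟨hcP, hcQ⟩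
  have hT := isSubcontinuum_connectedComponentIn (hP.1.inter_right hQ.isClosed) hPQ
  obtain ⟨t, htT, htP'⟩ := connectedComponentIn_inter_nonempty hP hP'.isClosed hQ.isClosed
    (hcov ▸ subset_univ P) ⟨q, hq, hqP'⟩ hPQ
  have hcT : c ∈ connectedComponentIn (P ∩ Q) c := mem_connectedComponentIn hPQ
  have hTs : connectedComponentIn (P ∩ Q) c ⊆ P ∩ Q := connectedComponentIn_subset _ _
  set T := connectedComponentIn (P ∩ Q) c
  obtain ⟨w, hwP', hwQ⟩ : (P' ∩ Q).Nonempty := by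
    have := isPreconnected_closed_iff.1 (isPreconnected_univ (α := X)) P' Q hP'.isClosed
      hQ.isClosed hcov.ge ⟨q, mem_univ q, hqP'⟩ ⟨p, mem_univ p, hpQ⟩
    rwa [univ_inter] at this
  have main : ∀ Q₁ Q₂ : Set X, IsSubcontinuum Q₁ → Q₁ ⊆ Q → Q₁ ≠ Q → IsSubcontinuum Q₂ →
      Q₂ ⊆ Q → Q₂ ≠ Q → Q₁ ∪ Q₂ = Q → p ∈ Q₂ → False := by
    intro Q₁ Q₂ hQ₁ hs₁ hn₁ hQ₂ hs₂ hn₂ hQQ hp₂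
    have hno : ∀ S : Set X, IsSubcontinuum S → S ⊆ Q → S ≠ Q → p ∈ S → ¬ (S ∩ P').Nonempty := by
      intro S hS hSQ hSne hpS hmeet
      exact hSne (Subset.antisymm hSQ (key S hS.isClosed
        (h.eq_univ (hS.union hP' hmeet) (Or.inl hpS) (Or.inr hqP'))))
    have hw₁ : w ∈ Q₁ := (hQQ ▸ hwQ : w ∈ Q₁ ∪ Q₂).resolve_right
      fun hw => hno Q₂ hQ₂ hs₂ hn₂ hp₂ ⟨w, hw, hwP'⟩
    have hp₁ : p ∉ P' ∪ Q₁ := by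
      rintro (hp | hp)
      · exact hne (h.eq_univ hP (hP'P hp) hq)
      · exact hno Q₁ hQ₁ hs₁ hn₁ hp ⟨w, hw₁, hwP'⟩
    have hsub := subset_composant (hP'.union hQ₁ ⟨w, hwP', hw₁⟩)
      (fun hu => hp₁ (hu ▸ mem_univ p)) (Or.inl hqP' : q ∈ P' ∪ Q₁)
    have hc₂ : c ∈ Q₂ := by
      refine closure_minimal (fun x hx => ?_) hQ₂.isClosed hcC
      rcases (hcov ▸ mem_univ x : x ∈ P' ∪ Q) with hx' | hx'
      · exact absurd (hsub (Or.inl hx')) hx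
      · exact (hQQ ▸ hx' : x ∈ Q₁ ∪ Q₂).resolve_left fun hx₁ => hx (hsub (Or.inr hx₁))
    have huniv : Q₂ ∪ T ∪ P' = univ := h.eq_univ
      ((hQ₂.union hT ⟨c, hc₂, hcT⟩).union hP' ⟨t, Or.inr htT, htP'⟩)
      (Or.inl (Or.inl hp₂)) (Or.inr hqP')
    have hTsub : (Q₂ ∪ P')ᶜ ⊆ T := by
      intro x hx
      rcases (huniv ▸ mem_univ x : x ∈ Q₂ ∪ T ∪ P') with (hx' | hx') | hx'
      · exact absurd (Or.inl hx') hx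
      · exact hx'
      · exact absurd (Or.inr hx') hx
    have hsubint : (Q₂ ∪ P')ᶜ ⊆ Qᶜ := by
      rw [← hintQ]
      exact interior_maximal (hTsub.trans (hTs.trans inter_subset_left))
        (hQ₂.isClosed.union hP'.isClosed).isOpen_compl
    refine hn₂ (Subset.antisymm hs₂ (key Q₂ hQ₂.isClosed (eq_univ_of_forall fun x => ?_)))
    by_contra hx
    exact hsubint hx (hTs (hTsub hx)).2
  rintro ⟨Q₁, Q₂, hk₁, hcn₁, hs₁, hn₁, hk₂, hcn₂, hs₂, hn₂, hQQ⟩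
  rcases (hQQ ▸ hpQ : p ∈ Q₁ ∪ Q₂) with hp | hp
  · exact main Q₂ Q₁ ⟨hk₂, hcn₂⟩ hs₂ hn₂ ⟨hk₁, hcn₁⟩ hs₁ hn₁ (by rw [union_comm, hQQ]) hp
  · exact main Q₁ Q₂ ⟨hk₁, hcn₁⟩ hs₁ hn₁ ⟨hk₂, hcn₂⟩ hs₂ hn₂ hQQ hp

/-- Moving `q` within the complement of the composant of `p` preserves irreducibility and the
composant of `q`. -/
theorem IrrBetween.of_notMem_composant {X : Type*} [TopologicalSpace X] {p q q' : X}
    (h : IrrBetween p q) {A A' : Set X} (hA : IsSubcontinuum A) (hA' : IsSubcontinuum A')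
    (hp : p ∈ A) (hq : q ∈ A') (hne : A ≠ univ) (hne' : A' ≠ univ) (hcov : A ∪ A' = univ)
    (hq' : q' ∉ composant p) :
    IrrBetween p q' ∧ composant q' = composant q ∧ q' ∈ A' := by
  have hq'A' : q' ∈ A' := (hcov ▸ mem_univ q' : q' ∈ A ∪ A').resolve_left
    fun hx => hq' (subset_composant hA hne hp hx)
  have hirr : IrrBetween p q' := fun L hL hL' hpL hqL =>
    by_contra fun hLne => hq' (subset_composant ⟨hL, hL'⟩ hLne hpL hqL)
  have key : ∀ a b : X, IrrBetween p a → IrrBetween p b → a ∈ A' → b ∈ A' →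
      composant a ⊆ composant b := by
    intro a b ha hb haA hbA x hx
    obtain ⟨L, hL, hLne, haL, hxL⟩ := exists_of_mem_composant hx
    refine subset_composant (hL.union hA' ⟨a, haL, haA⟩) ?_ (Or.inr hbA) (Or.inl hxL)
    intro hu
    rcases (hu ▸ mem_univ p : p ∈ L ∪ A') with hp' | hp'
    · exact hLne (ha.eq_univ hL hp' haL)
    · exact hne' (ha.eq_univ hA' hp' haA)
  exact ⟨hirr, (key _ _ hirr h hq'A' hq).antisymm (key _ _ h hirr hq hq'A'), hq'A'⟩

theorem NotBlocks.exists_isSubcontinuum {X : Type*} [TopologicalSpace X] {B : Set X} {x : X}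
    (h : NotBlocks B x) {O : Set X} (hO : IsOpen O) (hne : O.Nonempty) :
    ∃ M : Set X, IsSubcontinuum M ∧ x ∈ M ∧ M ⊆ Bᶜ ∧ (M ∩ O).Nonempty := by
  obtain ⟨y, hyO, M, ⟨hM, hM', hxM, hMB⟩, hyM⟩ := dense_iff_inter_open.1 h O hO hne
  exact ⟨M, ⟨hM, hM'⟩, hxM, hMB, y, hyM, hyO⟩

theorem interior_eq_empty_of_mem_NB {X : Type*} [TopologicalSpace X] {B : Set X}
    (hB : B ∈ NB X) : interior B = ∅ := by
  obtain ⟨x, hx⟩ := (ne_univ_iff_exists_notMem B).1 hB.2.1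
  by_contra hne
  obtain ⟨M, -, -, hMB, y, hyM, hyB⟩ := (hB.2.2.2 x hx).exists_isSubcontinuum isOpen_interior
    (nonempty_iff_ne_empty.2 hne)
  exact hMB hyM (interior_subset hyB)

/-- If a member `B` of `NB X` contains the complements of both composants, then every point `c`
of `B ∩ A`, where `A` is a subcontinuum containing `p`, is avoided by some continuum which
contains `q` and is not contained in a given proper subcontinuum `P ⊇ A'`. -/
theorem IrrBetween.exists_avoiding {X : Type*} [TopologicalSpace X] [T2Space X]
    [CompactSpace X] [ConnectedSpace X] [SecondCountableTopology X] {p q c : X}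
    (h : IrrBetween p q) {A A' P B : Set X} (hA : IsSubcontinuum A) (hp : p ∈ A)
    (hne : A ≠ univ) (hcov : A ∪ A' = univ) (hP : IsSubcontinuum P) (hPne : P ≠ univ)
    (hA'P : A' ⊆ P) (hB : B ∈ NB X) (hDB : (composant p)ᶜ ⊆ B) (hcB : c ∈ B) (hcA : c ∈ A) :
    ∃ M : Set X, IsSubcontinuum M ∧ q ∈ M ∧ c ∉ M ∧ ¬ M ⊆ P := by
  have hintB := interior_eq_empty_of_mem_NB hB
  obtain ⟨x, hx⟩ := (ne_univ_iff_exists_notMem B).1 hB.2.1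
  have hxB := hB.2.2.2 x hx
  by_contra hcon
  have hPA : Pᶜ ⊆ A := fun y hy => (hcov ▸ mem_univ y : y ∈ A ∪ A').resolve_right
    fun hy' => hy (hA'P hy')
  have hqA : q ∉ A := fun hq => hne (h.eq_univ hA hp hq)
  have hqB : q ∈ B := hDB fun hq => by
    obtain ⟨L, hL, hLne, hpL, hqL⟩ := exists_of_mem_composant hq
    exact hLne (h.eq_univ hL hpL hqL)
  have key : ∀ M : Set X, IsSubcontinuum M → x ∈ M → M ⊆ Bᶜ → (M ∩ Pᶜ).Nonempty →
      Aᶜ ⊆ closure (M ∪ A)ᶜ := by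
    rintro M hM hxM hMB ⟨y, hyM, hyP⟩
    have hMA := hM.union hA ⟨y, hyM, hPA hyP⟩
    have hqMA : q ∉ M ∪ A := by
      rintro (hq | hq)
      · exact hMB hq hqB
      · exact hqA hq
    obtain ⟨hK, hqK⟩ := h.symm.isSubcontinuum_closure_compl hMA (Or.inr hp)
      fun hu => hqMA (hu ▸ mem_univ q)
    have hcK : c ∈ closure (M ∪ A)ᶜ := by
      by_contra hcK
      obtain ⟨M₂, hM₂, hxM₂, hM₂B, z, hzM₂, hz⟩ := hxB.exists_isSubcontinuum
        hMA.isClosed.isOpen_compl ⟨q, hqMA⟩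
      refine hcon ⟨closure (M ∪ A)ᶜ ∪ (M ∪ M₂), hK.union (hM.union hM₂ ⟨x, hxM, hxM₂⟩)
        ⟨z, subset_closure hz, Or.inr hzM₂⟩, Or.inl hqK, ?_,
        fun hs => hyP (hs (Or.inr (Or.inl hyM)))⟩
      rintro (hc | hc | hc)
      exacts [hcK hc, hMB hc hcB, hM₂B hc hcB]
    have huniv := h.eq_univ (hK.union hA ⟨c, hcK, hcA⟩) (Or.inr hp) (Or.inl hqK)
    exact fun y hy => (huniv ▸ mem_univ y : y ∈ closure (M ∪ A)ᶜ ∪ A).resolve_right hy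
  obtain ⟨hQ, hqQ⟩ := h.symm.isSubcontinuum_closure_compl hA hp hne
  have hQs : ∀ S : Set X, IsSubcontinuum S → S ∪ A = univ → closure Aᶜ ⊆ S := by
    intro S hS hu
    exact closure_minimal
      (fun y hy => (hu ▸ mem_univ y : y ∈ S ∪ A).resolve_right hy) hS.isClosed
  have main : ∀ Q₁ Q₂ : Set X, IsSubcontinuum Q₁ → Q₁ ⊆ closure Aᶜ → Q₁ ≠ closure Aᶜ →
      IsSubcontinuum Q₂ → Q₂ ⊆ closure Aᶜ → Q₂ ≠ closure Aᶜ → Q₁ ∪ Q₂ = closure Aᶜ →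
      q ∈ Q₂ → False := by
    intro Q₁ Q₂ hQ₁ hs₁ hn₁ hQ₂ hs₂ hn₂ hQQ hq₂
    obtain ⟨y, hy⟩ := (ne_univ_iff_exists_notMem (Q₁ ∪ A)).1
      fun hu => hn₁ (hs₁.antisymm (hQs Q₁ hQ₁ hu))
    obtain ⟨w, hw⟩ := (ne_univ_iff_exists_notMem (Q₂ ∪ A)).1
      fun hu => hn₂ (hs₂.antisymm (hQs Q₂ hQ₂ hu))
    obtain ⟨M₁, hM₁, hxM₁, hM₁B, z, hzM₁, hz⟩ := hxB.exists_isSubcontinuum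
      (hQ₁.isClosed.union hA.isClosed).isOpen_compl ⟨y, hy⟩
    obtain ⟨M₂, hM₂, hxM₂, hM₂B, v, hvM₂, hv⟩ := hxB.exists_isSubcontinuum
      hP.isClosed.isOpen_compl (nonempty_compl.2 hPne)
    have hz₂ : z ∈ Q₂ := by
      have hzQ : z ∈ Q₁ ∪ Q₂ := hQQ ▸ subset_closure fun hzA => hz (Or.inr hzA)
      exact hzQ.resolve_left fun hz₁ => hz (Or.inl hz₁)
    have hM := hM₁.union hM₂ ⟨x, hxM₁, hxM₂⟩
    have huniv := h.eq_univ ((hM.union hQ₂ ⟨z, Or.inl hzM₁, hz₂⟩).union hA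
      ⟨v, Or.inl (Or.inr hvM₂), hPA hv⟩) (Or.inr hp) (Or.inl (Or.inr hq₂))
    have hsub : (Q₂ ∪ A)ᶜ ⊆ M₁ ∪ M₂ := by
      intro u hu
      rcases (huniv ▸ mem_univ u : u ∈ M₁ ∪ M₂ ∪ Q₂ ∪ A) with (hu' | hu') | hu'
      · exact hu'
      · exact absurd (Or.inl hu') hu
      · exact absurd (Or.inr hu') hu
    have hwK := key _ hM (Or.inl hxM₁) (union_subset hM₁B hM₂B) ⟨v, Or.inr hvM₂, hv⟩
      (fun hwA => hw (Or.inr hwA) : w ∈ Aᶜ)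
    obtain ⟨u, hu, hu'⟩ := mem_closure_iff.1 hwK _
      (hQ₂.isClosed.union hA.isClosed).isOpen_compl hw
    exact hu' (Or.inl (hsub hu))
  have hdec : ¬ DecomposableSet (closure Aᶜ) := by
    rintro ⟨Q₁, Q₂, hk₁, hcn₁, hs₁, hn₁, hk₂, hcn₂, hs₂, hn₂, hQQ⟩
    rcases (hQQ ▸ hqQ : q ∈ Q₁ ∪ Q₂) with hq | hq
    · exact main Q₂ Q₁ ⟨hk₂, hcn₂⟩ hs₂ hn₂ ⟨hk₁, hcn₁⟩ hs₁ hn₁ (by rw [union_comm, hQQ]) hq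
    · exact main Q₁ Q₂ ⟨hk₁, hcn₁⟩ hs₁ hn₁ ⟨hk₂, hcn₂⟩ hs₂ hn₂ hQQ hq
  have hsub : Aᶜ ⊆ interior B := interior_maximal
    ((h.symm.compl_subset_closure hA hp hne hdec).trans (closure_minimal hDB hB.2.2.1))
    hA.isClosed.isOpen_compl
  rw [hintB] at hsub
  exact hsub hqA

/-- If a member of `NB X` contains the complement of the composant of `q`, and contains the
complement of the composant of `p` or misses `q`, then the composant of `q` is open. -/
theorem IrrBetween.isClosed_compl_composant {X : Type*} [TopologicalSpace X] [T2Space X]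
    [CompactSpace X] [ConnectedSpace X] [SecondCountableTopology X] {p q : X}
    (h : IrrBetween p q) {A A' B : Set X} (hA : IsSubcontinuum A) (hA' : IsSubcontinuum A')
    (hp : p ∈ A) (hq : q ∈ A') (hne : A ≠ univ) (hne' : A' ≠ univ) (hcov : A ∪ A' = univ)
    (hB : B ∈ NB X) (hCB : (composant q)ᶜ ⊆ B) (hDB : (composant p)ᶜ ⊆ B ∨ q ∉ B) :
    IsClosed (composant q)ᶜ := by
  by_contra hcl
  have hintB := interior_eq_empty_of_mem_NB hB
  obtain ⟨c, hcC, hc⟩ : ∃ c ∈ closure (composant q)ᶜ, c ∉ (composant q)ᶜ := by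
    by_contra! hcon
    exact hcl (closure_subset_iff_isClosed.1 hcon)
  have hclB : closure (composant q)ᶜ ⊆ B := closure_minimal hCB hB.2.2.1
  have hclA : closure (composant q)ᶜ ⊆ A := closure_minimal
    (fun y hy => (hcov ▸ mem_univ y : y ∈ A ∪ A').resolve_right
      fun hy' => hy (subset_composant hA' hne' hq hy')) hA.isClosed
  obtain ⟨N, hN, hNne, hqN, hcN⟩ := exists_of_mem_composant (not_notMem.1 hc)
  have hP : IsSubcontinuum (N ∪ A') := hN.union hA' ⟨q, hqN, hq⟩
  have hqP : q ∈ N ∪ A' := Or.inl hqN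
  have hcP : c ∈ N ∪ A' := Or.inl hcN
  have hA'P : A' ⊆ N ∪ A' := subset_union_right
  have hpP : p ∉ N ∪ A' := by
    rintro (hp' | hp')
    · exact hNne (h.eq_univ hN hp' hqN)
    · exact hne' (h.eq_univ hA' hp' hq)
  generalize N ∪ A' = P at *
  have hPne : P ≠ univ := fun hu => hpP (hu ▸ mem_univ p)
  have hAP : Aᶜ ⊆ interior P := interior_maximal
    (fun y hy => hA'P ((hcov ▸ mem_univ y : y ∈ A ∪ A').resolve_left hy))
    hA.isClosed.isOpen_compl
  obtain ⟨M, hM, hqM, hcM, hMP⟩ : ∃ M : Set X, IsSubcontinuum M ∧ q ∈ M ∧ c ∉ M ∧ ¬ M ⊆ P := by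
    rcases hDB with hDB | hqB
    · exact h.exists_avoiding hA hp hne hcov hP hPne hA'P hB hDB (hclB hcC) (hclA hcC)
    · obtain ⟨M, hM, hqM, hMB, y, hyM, hyP⟩ := (hB.2.2.2 q hqB).exists_isSubcontinuum
        hP.isClosed.isOpen_compl ⟨p, hpP⟩
      exact ⟨M, hM, hqM, fun hcM => hMB hcM (hclB hcC), fun hs => hyP (hs hyM)⟩
  obtain ⟨y, hyM, hyP⟩ := not_subset.1 hMP
  obtain ⟨hQ, hpQ⟩ := h.isSubcontinuum_closure_compl hP hqP hPne
  have huniv := h.eq_univ (hM.union hQ ⟨y, hyM, subset_closure hyP⟩) (Or.inr hpQ) (Or.inl hqM)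
  have hPM : closure (interior P) ⊆ M := by
    refine closure_minimal (fun z hz => ?_) hM.isClosed
    refine (huniv ▸ mem_univ z : z ∈ M ∪ closure Pᶜ).resolve_right ?_
    rw [closure_compl]
    exact fun hz' => hz' hz
  have hdec := h.not_decomposableSet_closure_compl hP hqP hPne
    ((nonempty_compl.2 hne).mono hAP) hcC hcP (fun hcP' => hcM (hPM hcP'))
  have hsub : Pᶜ ⊆ interior B := interior_maximal
    ((h.compl_subset_closure hP hqP hPne hdec).trans hclB) hP.isClosed.isOpen_compl
  rw [hintB] at hsub
  exact hsub hpP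

/-- No member of `NB X` misses both points of irreducibility of a decomposable continuum. -/
theorem IrrBetween.mem_or_mem_of_mem_NB {X : Type*} [TopologicalSpace X] [T2Space X] {p q : X}
    (h : IrrBetween p q) {A A' B : Set X} (hA : IsSubcontinuum A) (hA' : IsSubcontinuum A')
    (hq : q ∈ A') (hne : A ≠ univ) (hne' : A' ≠ univ) (hcov : A ∪ A' = univ)
    (hB : B ∈ NB X) : p ∈ B ∨ q ∈ B := by
  by_contra! hpq
  obtain ⟨M, hM, hpM, hMB, y, hyM, hyA⟩ := (hB.2.2.2 p hpq.1).exists_isSubcontinuum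
    hA.isClosed.isOpen_compl (nonempty_compl.2 hne)
  obtain ⟨L, hL, hqL, hLB, z, hzL, hzA'⟩ := (hB.2.2.2 q hpq.2).exists_isSubcontinuum
    hA'.isClosed.isOpen_compl (nonempty_compl.2 hne')
  have hyA' : y ∈ A' := (hcov ▸ mem_univ y : y ∈ A ∪ A').resolve_left hyA
  have huniv := h.eq_univ (hM.union hA' ⟨y, hyM, hyA'⟩) (Or.inl hpM) (Or.inr hq)
  have hzM : z ∈ M := (huniv ▸ mem_univ z : z ∈ M ∪ A').resolve_right hzA'
  have huniv' := h.eq_univ (hM.union hL ⟨z, hzM, hzL⟩) (Or.inl hpM) (Or.inr hqL)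
  obtain ⟨b, hb⟩ := hB.1
  exact union_subset hMB hLB (huniv' ▸ mem_univ b : b ∈ M ∪ L) hb

theorem IrrBetween.isClosed_or_isClosed_of_mem_NB {X : Type*} [TopologicalSpace X] [T2Space X]
    [CompactSpace X] [ConnectedSpace X] [SecondCountableTopology X] {p q : X}
    (h : IrrBetween p q) {A A' B : Set X} (hA : IsSubcontinuum A) (hA' : IsSubcontinuum A')
    (hp : p ∈ A) (hq : q ∈ A') (hne : A ≠ univ) (hne' : A' ≠ univ) (hcov : A ∪ A' = univ)
    (hB : B ∈ NB X) : IsClosed (composant q)ᶜ ∨ IsClosed (composant p)ᶜ := by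
  have hcov' : A' ∪ A = univ := by rw [union_comm, hcov]
  by_cases hCB : (composant q)ᶜ ⊆ B
  · left
    by_cases hDB : (composant p)ᶜ ⊆ B
    · exact h.isClosed_compl_composant hA hA' hp hq hne hne' hcov hB hCB (Or.inl hDB)
    · obtain ⟨q', hq', hq'B⟩ := not_subset.1 hDB
      obtain ⟨h', heq, hq'A'⟩ := h.of_notMem_composant hA hA' hp hq hne hne' hcov hq'
      rw [← heq] at hCB ⊢
      exact h'.isClosed_compl_composant hA hA' hp hq'A' hne hne' hcov hB hCB (Or.inr hq'B)
  · right
    obtain ⟨p', hp', hp'B⟩ := not_subset.1 hCB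
    obtain ⟨h', heq, hp'A⟩ := h.symm.of_notMem_composant hA' hA hq hp hne' hne hcov' hp'
    have hDB : (composant p)ᶜ ⊆ B := by
      rw [← heq]
      intro q' hq'
      obtain ⟨h'', -, hq'A'⟩ := h'.symm.of_notMem_composant hA hA' hp'A hq hne hne' hcov hq'
      exact (h''.mem_or_mem_of_mem_NB hA hA' hq'A' hne hne' hcov hB).resolve_left hp'B
    rw [← heq] at hDB ⊢
    exact h'.isClosed_compl_composant hA' hA hq hp'A hne' hne hcov' hB hDB (Or.inr hp'B)

/-- If the complement of a composant is nonempty and closed, it belongs to `NB X`. -/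
theorem compl_composant_mem_NB {X : Type*} [TopologicalSpace X] [T2Space X] [CompactSpace X]
    [ConnectedSpace X] [Nontrivial X] {z : X} (hne : (composant z)ᶜ.Nonempty)
    (hcl : IsClosed (composant z)ᶜ) : (composant z)ᶜ ∈ NB X := by
  refine ⟨hne, ?_, hcl, ?_⟩
  · intro hu
    obtain ⟨y, hy⟩ := (dense_composant z).nonempty
    exact (hu ▸ mem_univ y : y ∈ (composant z)ᶜ) hy
  · intro x hx
    obtain ⟨L, hL, hLne, hzL, hxL⟩ := exists_of_mem_composant (not_notMem.1 hx)
    refine (dense_composant z).mono fun y hy => ?_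
    obtain ⟨M, hM, hMne, hzM, hyM⟩ := exists_of_mem_composant hy
    have hLM := hL.union hM ⟨z, hzL, hzM⟩
    refine ⟨L ∪ M, ⟨hLM.1, hLM.2, Or.inl hxL, ?_⟩, Or.inr hyM⟩
    rw [compl_compl]
    exact union_subset (subset_composant hL hLne hzL) (subset_composant hM hMne hzM)

theorem stmt11 (X : Type*) [MetricSpace X] [CompactSpace X] [ConnectedSpace X] [Nonempty X]
    (p q : X) (hdec : DecomposableSet (univ : Set X)) (hirr : IrrBetween p q)
    (C D : Set X) (hC : C = (composant q)ᶜ) (hD : D = (composant p)ᶜ) :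
    (¬ (C.Nonempty ∧ IsClosed C) ∧ ¬ (D.Nonempty ∧ IsClosed D)) ↔ NB X = ∅ := by
  obtain ⟨A, A', hAk, hAc, -, hne, hAk', hAc', -, hne', hcov⟩ := hdec
  have hA : IsSubcontinuum A := ⟨hAk, hAc⟩
  have hA' : IsSubcontinuum A' := ⟨hAk', hAc'⟩
  have hX : Nontrivial X := by
    obtain ⟨a, ha⟩ := hAc.nonempty
    obtain ⟨b, hb⟩ := (ne_univ_iff_exists_notMem A).1 hne
    exact ⟨a, b, fun hab => hb (hab ▸ ha)⟩
  have hpC : p ∈ C := by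
    rw [hC]
    intro hpq
    obtain ⟨L, hL, hLne, hqL, hpL⟩ := exists_of_mem_composant hpq
    exact hLne (hirr.eq_univ hL hpL hqL)
  have hqD : q ∈ D := by
    rw [hD]
    intro hpq
    obtain ⟨L, hL, hLne, hpL, hqL⟩ := exists_of_mem_composant hpq
    exact hLne (hirr.eq_univ hL hpL hqL)
  constructor
  · rintro ⟨hCn, hDn⟩
    by_contra hNB
    obtain ⟨B, hB⟩ := nonempty_iff_ne_empty.2 hNB
    have hor : IsClosed (composant q)ᶜ ∨ IsClosed (composant p)ᶜ := by
      rcases (hcov ▸ mem_univ p : p ∈ A ∪ A') with hp | hp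
      · have hq : q ∈ A' := (hcov ▸ mem_univ q : q ∈ A ∪ A').resolve_left
          fun hq => hne (hirr.eq_univ hA hp hq)
        exact hirr.isClosed_or_isClosed_of_mem_NB hA hA' hp hq hne hne' hcov hB
      · have hq : q ∈ A := (hcov ▸ mem_univ q : q ∈ A ∪ A').resolve_right
          fun hq => hne' (hirr.eq_univ hA' hp hq)
        exact hirr.isClosed_or_isClosed_of_mem_NB hA' hA hp hq hne' hne
          (by rw [union_comm, hcov]) hB
    rcases hor with hcl | hcl
    · exact hCn ⟨⟨p, hpC⟩, hC ▸ hcl⟩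
    · exact hDn ⟨⟨q, hqD⟩, hD ▸ hcl⟩
  · intro hNB
    subst hC hD
    refine ⟨fun hCc => ?_, fun hDc => ?_⟩
    · exact (hNB ▸ compl_composant_mem_NB hCc.1 hCc.2 : _ ∈ (∅ : Set (Set X)))
    · exact (hNB ▸ compl_composant_mem_NB hDc.1 hDc.2 : _ ∈ (∅ : Set (Set X)))
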